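/- For real a, b > 0 and real ν ≥ 0, ∫_0^∞ x K_ν(ax) J_ν(bx) dx = b^ν / (a^ν (a² + b²)). -/

import Mathlib

/-- Modified Bessel function of the second kind, via the integral representation
`K_ν(x) = ∫_0^∞ exp(-x cosh t) cosh(ν t) dt` (valid for `x > 0`). -/
noncomputable def besselK (ν x : ℝ) : ℝ :=
  ∫ t in Set.Ioi (0 : ℝ), Real.exp (-x * Real.cosh t) * Real.cosh (ν * t)

/-- Bessel function of the first kind, via its power series (real powers, for `x > 0`). -/
noncomputable def besselJ (ν x : ℝ) : ℝ :=
  ∑' k : ℕ, (-1) ^ k / (Nat.factorial k * Real.Gamma (k + ν + 1)) * (x / 2) ^ (2 * k + ν)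

open Real Set MeasureTheory Filter Topology

/-- `G μ y = ∑ (-1)^k y^k / (k! Γ(k+μ+1))`. -/
noncomputable def auxG (μ y : ℝ) : ℝ :=
  ∑' k : ℕ, (-1) ^ k / (Nat.factorial k * Real.Gamma (k + μ + 1)) * y ^ k

lemma aux_gamma_le (μ : ℝ) (hμ : 0 ≤ μ) (k : ℕ) : Gamma (μ + 1) ≤ Gamma (k + μ + 1) := by
  induction k with
  | zero => simp
  | succ k ih =>
    have h1 : ((k + 1 : ℕ) : ℝ) + μ + 1 = (k + μ + 1) + 1 := by push_cast; ring
    have hk : (0 : ℝ) ≤ k := Nat.cast_nonneg k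
    have hp : 0 < Gamma (k + μ + 1) := Gamma_pos_of_pos (by linarith)
    rw [h1, Gamma_add_one (s := (k : ℝ) + μ + 1) (by positivity)]
    nlinarith

lemma aux_gamma_pos (μ : ℝ) (hμ : 0 ≤ μ) (k : ℕ) : 0 < Gamma (k + μ + 1) :=
  Gamma_pos_of_pos (by have : (0 : ℝ) ≤ k := Nat.cast_nonneg k; linarith)

lemma aux_term_bound (μ : ℝ) (hμ : 0 ≤ μ) (R y : ℝ) (hy : |y| ≤ R) (k : ℕ) :
    ‖(-1) ^ k / (Nat.factorial k * Real.Gamma (k + μ + 1)) * y ^ k‖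
      ≤ (Gamma (μ + 1))⁻¹ * (R ^ k / Nat.factorial k) := by
  have h0 : 0 < Gamma (μ + 1) := Gamma_pos_of_pos (by linarith)
  have h1 := aux_gamma_pos μ hμ k
  have hf : (0 : ℝ) < Nat.factorial k := by exact_mod_cast Nat.factorial_pos k
  rw [norm_mul, norm_div, norm_pow, norm_pow, norm_mul, norm_neg, norm_one, one_pow,
    Real.norm_eq_abs, Real.norm_eq_abs, Real.norm_eq_abs, abs_of_pos hf, abs_of_pos h1]
  have : 1 / (↑k.factorial * Gamma (↑k + μ + 1)) * |y| ^ k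
      = (Gamma (k + μ + 1))⁻¹ * (|y| ^ k / Nat.factorial k) := by
    field_simp
  rw [this]
  have := aux_gamma_le μ hμ k
  gcongr

lemma aux_summable (μ : ℝ) (hμ : 0 ≤ μ) (y : ℝ) :
    Summable fun k : ℕ => (-1) ^ k / (Nat.factorial k * Real.Gamma (k + μ + 1)) * y ^ k :=
  Summable.of_norm_bounded ((Real.summable_pow_div_factorial |y|).mul_left _)
    (aux_term_bound μ hμ |y| y le_rfl)

lemma aux_shift (μ : ℝ) (y : ℝ) (k : ℕ) :
    (-1) ^ (k + 1) / (Nat.factorial (k + 1) * Real.Gamma ((k + 1 : ℕ) + μ + 1))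
        * (((k + 1 : ℕ) : ℝ) * y ^ k)
      = - ((-1) ^ k / (Nat.factorial k * Real.Gamma (k + (μ + 1) + 1)) * y ^ k) := by
  have h1 : ((k + 1 : ℕ) : ℝ) + μ + 1 = k + (μ + 1) + 1 := by push_cast; ring
  have hk : ((k + 1 : ℕ) : ℝ) ≠ 0 := by positivity
  have hf : (Nat.factorial k : ℝ) ≠ 0 := by positivity
  rw [h1, Nat.factorial_succ, Nat.cast_mul, pow_succ]
  field_simp

lemma aux_hasDerivAt (μ : ℝ) (hμ : 0 ≤ μ) (y : ℝ) :
    HasDerivAt (auxG μ) (- auxG (μ + 1) y) y := by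
  set R := |y| + 1 with hR
  let u : ℕ → ℝ := fun k => match k with
    | 0 => 0
    | k + 1 => (Gamma (μ + 1 + 1))⁻¹ * (R ^ k / Nat.factorial k)
  have hu : Summable u := by
    rw [← summable_nat_add_iff 1]
    exact (Real.summable_pow_div_factorial R).mul_left _
  have key := hasDerivAt_tsum_of_isPreconnected (𝕜 := ℝ) (F := ℝ) (y₀ := y) (y := y)
    (g := fun k z => (-1) ^ k / (Nat.factorial k * Real.Gamma (k + μ + 1)) * z ^ k)
    (g' := fun k z => (-1) ^ k / (Nat.factorial k * Real.Gamma (k + μ + 1)) * (k * z ^ (k - 1)))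
    hu (t := Metric.ball 0 R) Metric.isOpen_ball
    (convex_ball (0 : ℝ) R).isPreconnected
    (fun n z _ => (hasDerivAt_pow n z).const_mul _) ?_ (by simp [hR]) (aux_summable μ hμ y)
    (by simp [hR])
  · have h2 : ∑' k : ℕ, (-1) ^ k / (Nat.factorial k * Real.Gamma (k + μ + 1)) * (k * y ^ (k - 1))
        = - auxG (μ + 1) y := by
      have hs : Summable fun k : ℕ => (-1) ^ k / (Nat.factorial k * Real.Gamma (k + μ + 1)) *
          (k * y ^ (k - 1)) := by
        rw [← summable_nat_add_iff 1]
        refine ((aux_summable (μ + 1) (by linarith) y).neg).congr fun k => ?_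
        exact (aux_shift μ y k).symm
      rw [hs.tsum_eq_zero_add, auxG, ← tsum_neg]
      simp only [CharP.cast_eq_zero, zero_mul, mul_zero, zero_add]
      exact tsum_congr fun k => aux_shift μ y k
    rw [h2] at key
    exact key
  · intro n z hz
    have hz : |z| ≤ R := by simpa using (Metric.mem_ball.1 hz).le
    cases n with
    | zero => simp [u]
    | succ k =>
      have := aux_shift μ z k
      simp only [Nat.add_sub_cancel]
      rw [this, norm_neg]
      exact aux_term_bound (μ + 1) (by linarith) R z hz k

lemma aux_rec (μ : ℝ) (hμ : 0 ≤ μ) (y : ℝ) :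
    auxG μ y = (μ + 1) * auxG (μ + 1) y - y * auxG (μ + 1 + 1) y := by
  have h1 := aux_summable (μ + 1) (by linarith) y
  have h2 := aux_summable (μ + 1 + 1) (by linarith) y
  have hA : ∀ k : ℕ, (-1) ^ k / (Nat.factorial k * Real.Gamma (k + μ + 1)) * y ^ k
      = (μ + 1) * ((-1) ^ k / (Nat.factorial k * Real.Gamma (k + (μ + 1) + 1)) * y ^ k)
        + (-1) ^ k / (Nat.factorial k * Real.Gamma (k + (μ + 1) + 1)) * (k * y ^ k) := by
    intro k
    have hk : (0 : ℝ) ≤ k := Nat.cast_nonneg k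
    have e : (k : ℝ) + (μ + 1) + 1 = (k + μ + 1) + 1 := by ring
    have hp := (aux_gamma_pos μ hμ k).ne'
    have hne : (k : ℝ) + μ + 1 ≠ 0 := by positivity
    have hf : (Nat.factorial k : ℝ) ≠ 0 := by positivity
    rw [e, Gamma_add_one hne]
    field_simp
    ring
  have hB : ∀ k : ℕ, (-1) ^ (k + 1) / (Nat.factorial (k + 1) *
        Real.Gamma ((k + 1 : ℕ) + (μ + 1) + 1)) * (((k + 1 : ℕ) : ℝ) * y ^ (k + 1))
      = - y * ((-1) ^ k / (Nat.factorial k * Real.Gamma (k + (μ + 1 + 1) + 1)) * y ^ k) := by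
    intro k
    have := aux_shift (μ + 1) y k
    rw [pow_succ y k, ← mul_assoc _ (y ^ k) y, ← mul_assoc, this]
    ring
  have hs : Summable fun k : ℕ => (-1) ^ k / (Nat.factorial k *
      Real.Gamma (k + (μ + 1) + 1)) * (k * y ^ k) := by
    rw [← summable_nat_add_iff 1]
    exact (h2.mul_left (-y)).congr fun k => (hB k).symm
  have hS : ∑' k : ℕ, (-1) ^ k / (Nat.factorial k *
      Real.Gamma (k + (μ + 1) + 1)) * (k * y ^ k) = - y * auxG (μ + 1 + 1) y := by
    rw [hs.tsum_eq_zero_add, auxG, ← tsum_mul_left]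
    simp only [CharP.cast_eq_zero, zero_mul, mul_zero, zero_add]
    exact tsum_congr hB
  conv_lhs => rw [auxG, tsum_congr hA, (h1.mul_left (μ + 1)).tsum_add hs, tsum_mul_left, hS]
  rw [← auxG]
  ring

lemma aux_zero (μ : ℝ) : auxG μ 0 = (Gamma (μ + 1))⁻¹ := by
  rw [auxG, tsum_eq_single 0]
  · simp
  · intro k hk
    simp [hk]

lemma aux_continuous (μ : ℝ) (hμ : 0 ≤ μ) : Continuous (auxG μ) :=
  continuous_iff_continuousAt.2 fun y => (aux_hasDerivAt μ hμ y).continuousAt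

lemma aux_bound (μ : ℝ) (hμ : 0 ≤ μ) (y : ℝ) (hy : 0 ≤ y) :
    |auxG μ y| ≤ (Gamma (μ + 1))⁻¹ := by
  have h0 : 0 < Gamma (μ + 1) := Gamma_pos_of_pos (by linarith)
  have hd : ∀ z, HasDerivAt (fun z => auxG μ z ^ 2 + z * auxG (μ + 1) z ^ 2)
      (-(2 * μ + 1) * auxG (μ + 1) z ^ 2) z := by
    intro z
    have d0 := aux_hasDerivAt μ hμ z
    have d1 := aux_hasDerivAt (μ + 1) (by linarith) z
    have := (d0.pow 2).add ((hasDerivAt_id z).mul (d1.pow 2))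
    refine this.congr_deriv ?_
    have hr := aux_rec μ hμ z
    simp only [id, Nat.cast_ofNat, Pi.pow_apply]
    norm_num
    rw [hr]
    ring
  have hanti : AntitoneOn (fun z => auxG μ z ^ 2 + z * auxG (μ + 1) z ^ 2) (Ici 0) := by
    refine antitoneOn_of_deriv_nonpos (convex_Ici 0)
      (fun z _ => (hd z).continuousAt.continuousWithinAt)
      (fun z _ => (hd z).differentiableAt.differentiableWithinAt) ?_
    intro z _
    rw [(hd z).deriv]
    nlinarith [sq_nonneg (auxG (μ + 1) z)]
  have h := hanti (mem_Ici.2 le_rfl) (mem_Ici.2 hy) hy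
  simp only [zero_mul, add_zero, aux_zero] at h
  apply abs_le_of_sq_le_sq _ (by positivity)
  nlinarith [mul_nonneg hy (sq_nonneg (auxG (μ + 1) y))]

lemma aux_besselJ (ν x : ℝ) (hx : 0 < x) :
    besselJ ν x = (x / 2) ^ ν * auxG ν (x ^ 2 / 4) := by
  rw [besselJ, auxG, ← tsum_mul_left]
  refine tsum_congr fun k => ?_
  have : (x / 2) ^ (2 * (k : ℝ) + ν) = (x / 2) ^ ν * (x ^ 2 / 4) ^ k := by
    rw [rpow_add (by positivity), rpow_mul (by positivity), rpow_natCast, rpow_two, mul_comm]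
    ring
  rw [this]
  ring

lemma aux_integrable (z ν : ℝ) (hz : 0 < z) :
    Integrable fun u : ℝ => exp (-z * cosh u) * exp (-ν * u) := by
  have h := (integrable_cexp_quadratic (b := ((z / 4 : ℝ) : ℂ)) (by simpa using hz)
    ((-ν : ℝ) : ℂ) 0).norm
  refine h.mono' (by fun_prop) (ae_of_all _ fun u => ?_)
  rw [Complex.norm_exp, ← Real.exp_add, Real.norm_eq_abs, abs_of_pos (exp_pos _)]
  have : (-((z / 4 : ℝ) : ℂ) * (u : ℂ) ^ 2 + ((-ν : ℝ) : ℂ) * u + 0).re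
      = -(z / 4) * u ^ 2 + -ν * u := by
    have : (-((z / 4 : ℝ) : ℂ) * (u : ℂ) ^ 2 + ((-ν : ℝ) : ℂ) * u + 0)
      = ((-(z / 4) * u ^ 2 + -ν * u : ℝ) : ℂ) := by push_cast; ring
    rw [this, Complex.ofReal_re]
  rw [this]
  apply exp_le_exp.2
  have h1 : u ^ 2 / 4 ≤ cosh u := by
    rw [← cosh_abs, cosh_eq]
    have := quadratic_le_exp_of_nonneg (abs_nonneg u)
    have h2 := exp_pos (-|u|)
    have h3 := abs_nonneg u
    have h4 := sq_abs u
    linarith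
  nlinarith

lemma aux_besselK (z ν : ℝ) (hz : 0 < z) :
    besselK ν z = 1 / 2 * ∫ u : ℝ, exp (-z * cosh u) * exp (-ν * u) := by
  have h1 := aux_integrable z ν hz
  have h2 := aux_integrable z (-ν) hz
  have hneg : ∫ u : ℝ, exp (-z * cosh u) * exp (-ν * u)
      = ∫ u : ℝ, exp (-z * cosh u) * exp (-(-ν) * u) := by
    rw [← integral_neg_eq_self]
    simp
  have hsum : ∫ u : ℝ, exp (-z * cosh u) * cosh (ν * u)
      = ∫ u : ℝ, exp (-z * cosh u) * exp (-ν * u) := by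
    have : ∀ u : ℝ, exp (-z * cosh u) * cosh (ν * u) = 1 / 2 *
        (exp (-z * cosh u) * exp (-ν * u) + exp (-z * cosh u) * exp (-(-ν) * u)) := by
      intro u
      rw [cosh_eq (ν * u)]
      simp only [neg_neg, neg_mul]
      ring
    simp_rw [this]
    rw [integral_const_mul, integral_add h1 h2, ← hneg]
    ring
  have habs := integral_comp_abs (f := fun u : ℝ => exp (-z * cosh u) * cosh (ν * u))
  have : ∀ u : ℝ, exp (-z * cosh |u|) * cosh (ν * |u|) = exp (-z * cosh u) * cosh (ν * u) := by
    intro u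
    rcases abs_choice u with h | h <;> rw [h] <;> simp
  simp_rw [this] at habs
  rw [← hsum, habs, besselK]
  ring

lemma aux_besselK' (z ν : ℝ) (hz : 0 < z) :
    besselK ν z = 1 / 2 * (z / 2) ^ ν *
      ∫ t in Ioi (0 : ℝ), t ^ (-ν - 1) * exp (-t) * exp (-(z ^ 2 / (4 * t))) := by
  have himg : (fun u : ℝ => z / 2 * exp u) '' univ = Ioi 0 := by
    ext t
    simp only [image_univ, mem_range, mem_Ioi]
    constructor
    · rintro ⟨u, rfl⟩; positivity
    · intro ht
      refine ⟨log (t / (z / 2)), ?_⟩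
      rw [exp_log (by positivity)]
      field_simp
  rw [← himg, integral_image_eq_integral_abs_deriv_smul (f' := fun u => z / 2 * exp u)
    MeasurableSet.univ (fun u _ => ((hasDerivAt_exp u).const_mul (z / 2)).hasDerivWithinAt)
    (fun u _ v _ h => by
      have : z / 2 ≠ 0 := by positivity
      exact exp_injective (mul_left_cancel₀ this h)),
    aux_besselK z ν hz, setIntegral_univ, mul_assoc]
  congr 1
  rw [← integral_const_mul]
  refine integral_congr_ae (ae_of_all _ fun u => ?_)
  simp only [smul_eq_mul]
  rw [abs_of_pos (by positivity), mul_rpow (by positivity) (by positivity), ← exp_mul,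
    cosh_eq]
  have e1 : (z / 2) ^ (-ν - 1) = ((z / 2) ^ ν)⁻¹ * (z / 2)⁻¹ := by
    rw [rpow_sub (by positivity), rpow_neg (by positivity), rpow_one]; rfl
  have e2 : exp (u * (-ν - 1)) = exp (-ν * u) * (exp u)⁻¹ := by
    rw [← exp_neg, ← exp_add]; congr 1; ring
  have e3 : exp (-z * ((exp u + exp (-u)) / 2)) =
      exp (-(z / 2 * exp u)) * exp (-(z ^ 2 / (4 * (z / 2 * exp u)))) := by
    rw [← exp_add]
    congr 1
    rw [exp_neg]
    field_simp
    ring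
  rw [e1, e2, e3]
  have : (z / 2) ^ ν ≠ 0 := by positivity
  have : exp u ≠ 0 := by positivity
  field_simp

lemma aux_moment (s p : ℝ) (hs : 0 ≤ s) (hp : 0 < p) :
    IntegrableOn (fun x : ℝ => x ^ (2 * s + 1) * exp (-p * x ^ 2)) (Ioi 0) ∧
    ∫ x in Ioi (0 : ℝ), x ^ (2 * s + 1) * exp (-p * x ^ 2)
      = 1 / 2 * p ^ (-(s + 1)) * Gamma (s + 1) := by
  refine ⟨integrableOn_rpow_mul_exp_neg_mul_sq hp (by linarith), ?_⟩
  have h := integral_rpow_mul_exp_neg_mul_rpow (p := 2) (q := 2 * s + 1) (b := p) (by norm_num)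
    (by linarith) hp
  simp only [rpow_two] at h
  rw [h, show -(2 * s + 1 + 1) / 2 = -(s + 1) by ring, show (2 * s + 1 + 1) / 2 = s + 1 by ring]
  ring

lemma aux_weber (ν p c : ℝ) (hν : 0 ≤ ν) (hp : 0 < p) (hc : 0 < c) :
    ∫ x in Ioi (0 : ℝ), x ^ (2 * ν + 1) * exp (-p * x ^ 2) * auxG ν (c * x ^ 2)
      = 1 / 2 * p ^ (-(ν + 1)) * exp (-(c / p)) := by
  let A : ℕ → ℝ := fun k => (-1) ^ k / (Nat.factorial k * Real.Gamma (k + ν + 1)) * c ^ k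
  let F : ℕ → ℝ → ℝ := fun k x => A k * (x ^ (2 * (k + ν) + 1) * exp (-p * x ^ 2))
  have hm : ∀ k : ℕ, _ := fun k => aux_moment (k + ν) p (by positivity) hp
  have hFint : ∀ k, IntegrableOn (F k) (Ioi 0) := fun k => (hm k).1.const_mul _
  have hval : ∀ k, ∫ x in Ioi (0 : ℝ), F k x
      = 1 / 2 * p ^ (-(ν + 1)) * ((-(c / p)) ^ k / Nat.factorial k) := by
    intro k
    simp only [F, A]
    rw [integral_const_mul, (hm k).2]
    have hg := (aux_gamma_pos ν hν k).ne'
    have e : p ^ (-((k : ℝ) + ν + 1)) = p ^ (-(ν + 1)) * (p ^ k)⁻¹ := by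
      rw [← rpow_natCast p k, ← rpow_neg hp.le, ← rpow_add hp]; congr 1; ring
    rw [e, neg_pow (c / p), div_pow]
    field_simp
  have hnorm : ∀ k, ∫ x in Ioi (0 : ℝ), ‖F k x‖
      = 1 / 2 * p ^ (-(ν + 1)) * ((c / p) ^ k / Nat.factorial k) := by
    intro k
    have hg := (aux_gamma_pos ν hν k)
    have : ∫ x in Ioi (0 : ℝ), ‖F k x‖ = ∫ x in Ioi (0 : ℝ), (-1) ^ k * F k x := by
      refine setIntegral_congr_fun measurableSet_Ioi fun x hx => ?_
      have hx : 0 < x := hx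
      have h1 : (-1) ^ k * F k x = 1 / (Nat.factorial k * Real.Gamma (k + ν + 1)) * c ^ k
          * (x ^ (2 * (k + ν) + 1) * exp (-p * x ^ 2)) := by
        have : ((-1 : ℝ) ^ k) * (-1) ^ k = 1 := by rw [← mul_pow]; simp
        simp only [F, A]
        linear_combination (1 / (Nat.factorial k * Real.Gamma (k + ν + 1)) * c ^ k
          * (x ^ (2 * (k + ν) + 1) * exp (-p * x ^ 2))) * this
      have h2 : 0 ≤ (-1) ^ k * F k x := by rw [h1]; positivity
      have h3 : ‖F k x‖ = ‖(-1) ^ k * F k x‖ := by simp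
      simp only [h3]
      exact Real.norm_of_nonneg h2
    rw [this, integral_const_mul, hval, neg_pow (c / p)]
    have : ((-1 : ℝ) ^ k) * (-1) ^ k = 1 := by rw [← mul_pow]; simp
    linear_combination (1 / 2 * p ^ (-(ν + 1)) * ((c / p) ^ k / Nat.factorial k)) * this
  have hsum := hasSum_integral_of_summable_integral_norm (μ := volume.restrict (Ioi (0 : ℝ)))
    hFint (by
      simp_rw [hnorm]
      exact (Real.summable_pow_div_factorial _).mul_left _)
  simp_rw [hval] at hsum
  have hexp : HasSum (fun k : ℕ => (-(c / p)) ^ k / (Nat.factorial k : ℝ)) (exp (-(c / p))) := by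
    rw [Real.exp_eq_exp_ℝ]
    exact NormedSpace.expSeries_div_hasSum_exp _
  rw [(hexp.mul_left _).unique hsum]
  refine (setIntegral_congr_fun measurableSet_Ioi fun x hx => ?_)
  have hx : 0 < x := hx
  simp only [F, A, auxG]
  rw [← tsum_mul_left]
  refine tsum_congr fun k => ?_
  have : x ^ (2 * ((k : ℝ) + ν) + 1) = x ^ (2 * ν + 1) * (x ^ 2) ^ k := by
    rw [← rpow_natCast, ← rpow_two, ← rpow_mul hx.le, ← rpow_add hx]; congr 1; ring
  rw [this, mul_pow]
  ring

lemma aux_prod_integrable (a c ν : ℝ) (ha : 0 < a) (hc : 0 < c) (hν : 0 ≤ ν) :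
    Integrable (Function.uncurry fun x t : ℝ => t ^ (-ν - 1) * exp (-t) *
      (x ^ (2 * ν + 1) * exp (-(a ^ 2 / (4 * t)) * x ^ 2) * auxG ν (c * x ^ 2)))
      ((volume.restrict (Ioi (0 : ℝ))).prod (volume.restrict (Ioi (0 : ℝ)))) := by
  have hG := aux_continuous ν hν
  have hmeas0 : Measurable (Function.uncurry fun x t : ℝ => t ^ (-ν - 1) * exp (-t) *
      (x ^ (2 * ν + 1) * exp (-(a ^ 2 / (4 * t)) * x ^ 2))) := by
    simp only [Function.uncurry_def]
    fun_prop
  have hmeas : Measurable (Function.uncurry fun x t : ℝ => t ^ (-ν - 1) * exp (-t) *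
      (x ^ (2 * ν + 1) * exp (-(a ^ 2 / (4 * t)) * x ^ 2) * auxG ν (c * x ^ 2))) := by
    have := hG.measurable
    simp only [Function.uncurry_def]
    fun_prop
  have hI : Integrable (Function.uncurry fun x t : ℝ => t ^ (-ν - 1) * exp (-t) *
      (x ^ (2 * ν + 1) * exp (-(a ^ 2 / (4 * t)) * x ^ 2)))
      ((volume.restrict (Ioi (0 : ℝ))).prod (volume.restrict (Ioi (0 : ℝ)))) := by
    rw [integrable_prod_iff' hmeas0.aestronglyMeasurable]
    constructor
    · filter_upwards [ae_restrict_mem measurableSet_Ioi] with t ht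
      have ht : 0 < t := ht
      simp only [Function.uncurry]
      exact (aux_moment ν (a ^ 2 / (4 * t)) hν (by positivity)).1.const_mul _
    · have hexp : IntegrableOn (fun t : ℝ => 1 / 2 * (a ^ 2 / 4) ^ (-(ν + 1)) * Gamma (ν + 1)
          * exp (-t)) (Ioi 0) := (integrableOn_exp_neg_Ioi 0).const_mul _
      refine hexp.congr_fun (fun t ht => ?_) measurableSet_Ioi
      have ht : 0 < t := ht
      have e0 : ∫ x in Ioi (0 : ℝ), ‖Function.uncurry (fun x t : ℝ => t ^ (-ν - 1) * exp (-t) *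
          (x ^ (2 * ν + 1) * exp (-(a ^ 2 / (4 * t)) * x ^ 2))) (x, t)‖
          = ∫ x in Ioi (0 : ℝ), t ^ (-ν - 1) * exp (-t) *
          (x ^ (2 * ν + 1) * exp (-(a ^ 2 / (4 * t)) * x ^ 2)) := by
        refine setIntegral_congr_fun measurableSet_Ioi fun x hx => ?_
        have hx : 0 < x := hx
        exact Real.norm_of_nonneg (by simp only [Function.uncurry]; positivity)
      simp only []
      rw [e0, integral_const_mul, (aux_moment ν (a ^ 2 / (4 * t)) hν (by positivity)).2]
      have e1 : a ^ 2 / (4 * t) = a ^ 2 / 4 * t⁻¹ := by field_simp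
      have e2 : t ^ (-ν - 1) * (t⁻¹) ^ (-(ν + 1)) = 1 := by
        rw [inv_rpow ht.le, ← rpow_neg ht.le, ← rpow_add ht]
        simp
      rw [e1, mul_rpow (by positivity) (by positivity)]
      linear_combination -(1 / 2 * (a ^ 2 / 4) ^ (-(ν + 1)) * Gamma (ν + 1)
          * exp (-t)) * e2
  refine (hI.norm.const_mul (Gamma (ν + 1))⁻¹).mono' hmeas.aestronglyMeasurable
    (ae_of_all _ fun q => ?_)
  simp only [Function.uncurry]
  rw [← mul_assoc, norm_mul, mul_comm]
  gcongr
  exact aux_bound ν hν _ (by positivity)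

theorem integral_besselK_besselJ (a b ν : ℝ) (ha : 0 < a) (hb : 0 < b) (hν : 0 ≤ ν) :
    ∫ x in Set.Ioi (0 : ℝ), x * besselK ν (a * x) * besselJ ν (b * x)
      = b ^ ν / (a ^ ν * (a ^ 2 + b ^ 2)) := by
  have hc : 0 < b ^ 2 / 4 := by positivity
  have step1 : ∫ x in Ioi (0 : ℝ), x * besselK ν (a * x) * besselJ ν (b * x)
      = ∫ x in Ioi (0 : ℝ), 1 / 2 * (a / 2) ^ ν * (b / 2) ^ ν * ∫ t in Ioi (0 : ℝ),
        t ^ (-ν - 1) * exp (-t) *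
      (x ^ (2 * ν + 1) * exp (-(a ^ 2 / (4 * t)) * x ^ 2) * auxG ν (b ^ 2 / 4 * x ^ 2)) := by
    refine setIntegral_congr_fun measurableSet_Ioi fun x hx => ?_
    have hx : 0 < x := hx
    have e0 : ∀ t : ℝ, t ^ (-ν - 1) * exp (-t) *
      (x ^ (2 * ν + 1) * exp (-(a ^ 2 / (4 * t)) * x ^ 2) * auxG ν (b ^ 2 / 4 * x ^ 2))
      = x ^ (2 * ν + 1) * auxG ν (b ^ 2 / 4 * x ^ 2) *
        (t ^ (-ν - 1) * exp (-t) * exp (-((a * x) ^ 2 / (4 * t)))) := by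
      intro t
      rw [show -(a ^ 2 / (4 * t)) * x ^ 2 = -((a * x) ^ 2 / (4 * t)) by ring]
      ring
    simp only [e0]
    rw [integral_const_mul, aux_besselK' _ ν (by positivity), aux_besselJ ν _ (by positivity)]
    have e1 : x ^ (2 * ν + 1) = x * x ^ ν * x ^ ν := by
      rw [rpow_add hx, two_mul, rpow_add hx, rpow_one]; ring
    have e2 : (b * x) ^ 2 / 4 = b ^ 2 / 4 * x ^ 2 := by ring
    have e3 : (a * x / 2) ^ ν = (a / 2) ^ ν * x ^ ν := by
      rw [← mul_rpow (by positivity) hx.le]; congr 1; ring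
    have e4 : (b * x / 2) ^ ν = (b / 2) ^ ν * x ^ ν := by
      rw [← mul_rpow (by positivity) hx.le]; congr 1; ring
    rw [e1, e2, e3, e4]
    ring
  rw [step1, integral_const_mul,
    integral_integral_swap (aux_prod_integrable a (b ^ 2 / 4) ν ha hc hν)]
  have step2 : ∫ t in Ioi (0 : ℝ), ∫ x in Ioi (0 : ℝ), t ^ (-ν - 1) * exp (-t) *
      (x ^ (2 * ν + 1) * exp (-(a ^ 2 / (4 * t)) * x ^ 2) * auxG ν (b ^ 2 / 4 * x ^ 2))
      = ∫ t in Ioi (0 : ℝ), 1 / 2 * (a ^ 2 / 4) ^ (-(ν + 1)) *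
        exp (-(1 + b ^ 2 / a ^ 2) * t) := by
    refine setIntegral_congr_fun measurableSet_Ioi fun t ht => ?_
    have ht : 0 < t := ht
    rw [integral_const_mul, aux_weber ν _ _ hν (by positivity) hc]
    have e1 : a ^ 2 / (4 * t) = a ^ 2 / 4 * t⁻¹ := by field_simp
    have e2 : t ^ (-ν - 1) * (t⁻¹) ^ (-(ν + 1)) = 1 := by
      rw [inv_rpow ht.le, ← rpow_neg ht.le, ← rpow_add ht]
      simp
    have e3 : exp (-(1 + b ^ 2 / a ^ 2) * t) =
        exp (-t) * exp (-(b ^ 2 / 4 / (a ^ 2 / 4 * t⁻¹))) := by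
      rw [← exp_add]; congr 1; field_simp; ring
    rw [e3, e1, mul_rpow (by positivity) (by positivity)]
    linear_combination (1 / 2 * (a ^ 2 / 4) ^ (-(ν + 1))
          * (exp (-t) * exp (-(b ^ 2 / 4 / (a ^ 2 / 4 * t⁻¹))))) * e2
  rw [step2, integral_const_mul, integral_exp_mul_Ioi (by
    have : 0 < b ^ 2 / a ^ 2 := by positivity
    linarith)]
  have e1 : (a ^ 2 / 4) ^ (-(ν + 1)) = ((a / 2) ^ ν)⁻¹ * ((a / 2) ^ ν)⁻¹ * (a ^ 2 / 4)⁻¹ := by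
    rw [show a ^ 2 / 4 = (a / 2) * (a / 2) by ring, rpow_neg (by positivity),
      rpow_add_one (by positivity), mul_rpow (by positivity) (by positivity), mul_inv, mul_inv]
  have h1 : (a / 2) ^ ν ≠ 0 := by positivity
  have h2 : a ^ ν ≠ 0 := by positivity
  have h3 : (2 : ℝ) ^ ν ≠ 0 := by positivity
  rw [e1, div_rpow ha.le (by norm_num), div_rpow hb.le (by norm_num)]
  simp only [mul_zero, exp_zero]
  have h4 : a ^ 2 + b ^ 2 ≠ 0 := by positivity
  have h5 : -(1 + b ^ 2 / a ^ 2) = -((a ^ 2 + b ^ 2) / a ^ 2) := by field_simp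
  rw [h5]
  field_simp
  norm_num
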